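/- Assume ε > 1/2, η satisfies (H₀)–(H₄) and V satisfies (H'₀)–(H'₃) (all with this ε), and set H̃ := Δ̃ + V(Q). Then for every compact set K ⊆ ℝ with K ∩ {−1/2, −1/3, 1} = ∅, the set of eigenvalues of H̃ lying in K is finite, and for each λ ∈ K the eigenspace ker(H̃ − λ) is finite-dimensional; in particular the eigenvalues of H̃ distinct from −1/2, −1/3, 1 have finite multiplicity and can accumulate only at −1/2, −1/3, 1. -/

import Mathlib

open scoped ENNReal
open Filter

noncomputable section

/-- The Hilbert space `ℓ²(ℤ², ℂ)`. -/
abbrev H2 : Type := lp (fun _ : ℤ × ℤ => ℂ) 2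

/-- The triangular-lattice Laplacian, acting pointwise on functions `ℤ² → ℂ`. -/
def lapT (f : ℤ × ℤ → ℂ) : ℤ × ℤ → ℂ := fun n =>
  (1/6 : ℂ) * (f (n.1 + 1, n.2) + f (n.1 - 1, n.2) + f (n.1, n.2 + 1)
    + f (n.1, n.2 - 1) + f (n.1 + 1, n.2 - 1) + f (n.1 - 1, n.2 + 1))

/-- The symbol `F(x₁,x₂) = (1/3)(cos x₁ + cos x₂ + cos (x₁ - x₂))`. -/
def symbF (x : ℝ × ℝ) : ℝ := (1/3) * (Real.cos x.1 + Real.cos x.2 + Real.cos (x.1 - x.2))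

/-- `∂₁ F`. -/
def d1F (x : ℝ × ℝ) : ℝ := -(1/3) * (Real.sin x.1 + Real.sin (x.1 - x.2))

/-- `∂₂ F`. -/
def d2F (x : ℝ × ℝ) : ℝ := -(1/3) * (Real.sin x.2 - Real.sin (x.1 - x.2))

/-- Japanese bracket `⟨t⟩ = √(1/2 + t²)`. -/
def jap (t : ℝ) : ℝ := Real.sqrt (1/2 + t^2)

/-- The weight `Λ(n₁,n₂) = ⟨n₁⟩ + ⟨n₂⟩`. -/
def Lam (n : ℤ × ℤ) : ℝ := jap (n.1 : ℝ) + jap (n.2 : ℝ)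

/-- The conjugate operator `A`, acting pointwise on functions `ℤ² → ℂ`. -/
def opA (f : ℤ × ℤ → ℂ) : ℤ × ℤ → ℂ := fun n =>
  (Complex.I / 6) *
    (((n.1 : ℂ) + 1/2) * f (n.1 + 1, n.2) - ((n.1 : ℂ) - 1/2) * f (n.1 - 1, n.2)
      + ((n.2 : ℂ) + 1/2) * f (n.1, n.2 + 1) - ((n.2 : ℂ) - 1/2) * f (n.1, n.2 - 1)
      + ((n.2 : ℂ) - (n.1 : ℂ) + 1) * f (n.1 - 1, n.2 + 1)
      + ((n.1 : ℂ) - (n.2 : ℂ) + 1) * f (n.1 + 1, n.2 - 1))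

/-- The perturbed Laplacian `Δ̃` with weight `m`, acting pointwise on functions `ℤ² → ℂ`:
`(Δ̃ f)(n) = (1/6) Σ_{l ∼ n} f(l) / (√(m n) √(m l))`. -/
def lapPert (m : ℤ × ℤ → ℝ) (f : ℤ × ℤ → ℂ) : ℤ × ℤ → ℂ := fun n =>
  (1/6 : ℂ) *
    (f (n.1 + 1, n.2) / ((Real.sqrt (m n) * Real.sqrt (m (n.1 + 1, n.2)) : ℝ) : ℂ)
      + f (n.1 - 1, n.2) / ((Real.sqrt (m n) * Real.sqrt (m (n.1 - 1, n.2)) : ℝ) : ℂ)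
      + f (n.1, n.2 + 1) / ((Real.sqrt (m n) * Real.sqrt (m (n.1, n.2 + 1)) : ℝ) : ℂ)
      + f (n.1, n.2 - 1) / ((Real.sqrt (m n) * Real.sqrt (m (n.1, n.2 - 1)) : ℝ) : ℂ)
      + f (n.1 + 1, n.2 - 1) / ((Real.sqrt (m n) * Real.sqrt (m (n.1 + 1, n.2 - 1)) : ℝ) : ℂ)
      + f (n.1 - 1, n.2 + 1) / ((Real.sqrt (m n) * Real.sqrt (m (n.1 - 1, n.2 + 1)) : ℝ) : ℂ))

theorem H2.summable_norm_sq (f : H2) : Summable fun n => ‖f n‖ ^ 2 := by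
  simpa using (memℓp_gen_iff (p := 2) (by norm_num)).1 (lp.memℓp f)

theorem H2.norm_sq_eq_tsum (f : H2) : ‖f‖ ^ 2 = ∑' n, ‖f n‖ ^ 2 := by
  simpa using lp.norm_rpow_eq_tsum (p := 2) (by norm_num) f

/-- Translation of the argument by `d`, as an isometry of `ℓ²(ℤ²)`. -/
def shiftIsom (d : ℤ × ℤ) : H2 →ₗᵢ[ℂ] H2 where
  toFun f := ⟨fun n => f (n + d), memℓp_gen (by
    simpa [Function.comp_def] using (Equiv.addRight d).summable_iff.2 f.summable_norm_sq)⟩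
  map_add' _ _ := rfl
  map_smul' _ _ := rfl
  norm_map' f := by
    have h : ∀ a b : ℝ, 0 ≤ a → 0 ≤ b → a ^ 2 = b ^ 2 → a = b := fun a b ha hb =>
      (pow_left_inj₀ ha hb two_ne_zero).1
    refine h _ _ (norm_nonneg _) (norm_nonneg _) ?_
    rw [H2.norm_sq_eq_tsum, H2.norm_sq_eq_tsum]
    exact (Equiv.addRight d).tsum_eq fun n => ‖f n‖ ^ 2

/-- Translation of the argument by `d`, as a bounded operator on `ℓ²(ℤ²)`. -/
def shift (d : ℤ × ℤ) : H2 →L[ℂ] H2 := (shiftIsom d).toContinuousLinearMap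

@[simp] theorem shift_apply (d : ℤ × ℤ) (f : H2) (n : ℤ × ℤ) : shift d f n = f (n + d) := rfl

@[simp] theorem norm_shift (d : ℤ × ℤ) (f : H2) : ‖shift d f‖ = ‖f‖ := (shiftIsom d).norm_map f

theorem shift_shift (d e : ℤ × ℤ) (f : H2) : shift d (shift e f) = shift (d + e) f := by
  ext n
  simp [add_assoc]

theorem inner_shift_left (d : ℤ × ℤ) (f g : H2) :
    inner ℂ (shift d f) g = inner ℂ f (shift (-d) g) := by
  have h : g = shift d (shift (-d) g) := by
    ext n
    simp
  conv_lhs => rw [h]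
  exact (shiftIsom d).inner_map_map _ _

/-- Multiplication by a bounded real function, as a bounded operator on `ℓ²(ℤ²)`. -/
def mulOp (a : ℤ × ℤ → ℝ) (ha : ∃ C, ∀ n, |a n| ≤ C) : H2 →L[ℂ] H2 :=
  LinearMap.mkContinuousOfExistsBound
    { toFun := fun f => ⟨fun n => (a n : ℂ) * f n, by
        obtain ⟨C, hC⟩ := ha
        refine ((lp.memℓp f).const_mul (C : ℂ)).mono' fun n => ?_
        have h0 : 0 ≤ C := (abs_nonneg _).trans (hC n)
        simp only [norm_mul, Complex.norm_real, Real.norm_eq_abs, abs_of_nonneg h0]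
        gcongr
        exact hC n⟩
      map_add' := fun f g => by
        ext n
        exact mul_add _ _ _
      map_smul' := fun c f => by
        ext n
        simp [mul_left_comm] }
    (by
      obtain ⟨C, hC⟩ := ha
      have h0 : 0 ≤ C := (abs_nonneg _).trans (hC 0)
      refine ⟨‖(C : ℂ)‖, fun f => ?_⟩
      rw [← norm_smul]
      refine lp.norm_mono (by norm_num) fun n => ?_
      simp only [lp.coeFn_smul, Pi.smul_apply, smul_eq_mul, norm_mul, Complex.norm_real,
        Real.norm_eq_abs, abs_of_nonneg h0]
      dsimp
      simp only [norm_mul, Complex.norm_real, Real.norm_eq_abs]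
      gcongr
      exact hC n)

@[simp] theorem mulOp_apply (a : ℤ × ℤ → ℝ) (ha : ∃ C, ∀ n, |a n| ≤ C) (f : H2) (n : ℤ × ℤ) :
    mulOp a ha f n = (a n : ℂ) * f n := rfl

theorem norm_mulOp_le_norm_mulOp {a b : ℤ × ℤ → ℝ} (ha : ∃ C, ∀ n, |a n| ≤ C)
    (hb : ∃ C, ∀ n, |b n| ≤ C) (hab : ∀ n, |a n| ≤ b n) (f : H2) :
    ‖mulOp a ha f‖ ≤ ‖mulOp b hb f‖ := by
  refine lp.norm_mono (by norm_num) fun n => ?_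
  simp only [mulOp_apply, norm_mul, Complex.norm_real, Real.norm_eq_abs]
  exact mul_le_mul_of_nonneg_right ((hab n).trans (le_abs_self _)) (norm_nonneg _)

theorem inner_mulOp_left (a : ℤ × ℤ → ℝ) (ha : ∃ C, ∀ n, |a n| ≤ C) (f g : H2) :
    inner ℂ (mulOp a ha f) g = inner ℂ f (mulOp a ha g) := by
  rw [lp.inner_eq_tsum, lp.inner_eq_tsum]
  refine tsum_congr fun n => ?_
  simp only [mulOp_apply, RCLike.inner_apply, map_mul, Complex.conj_ofReal]
  ring

theorem norm_inner_mulOp_le {a b : ℤ × ℤ → ℝ} (ha : ∃ C, ∀ n, |a n| ≤ C)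
    (hb : ∃ C, ∀ n, |b n| ≤ C) (hab : ∀ n, |a n| ≤ b n) (f g : H2) :
    ‖inner ℂ f (mulOp a ha g)‖ ≤ ‖mulOp b hb f‖ * ‖g‖ := by
  rw [← inner_mulOp_left]
  refine (norm_inner_le_norm _ _).trans ?_
  gcongr
  exact norm_mulOp_le_norm_mulOp ha hb hab f

theorem tendsto_inner_mulOp {a : ℕ → ℤ × ℤ → ℝ} {b : ℤ × ℤ → ℝ} {C : ℝ}
    (ha : ∀ R n, |a R n| ≤ C) (hb : ∃ C, ∀ n, |b n| ≤ C)
    (hab : ∀ n, Tendsto (fun R => a R n) atTop (nhds (b n))) (f g : H2) :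
    Tendsto (fun R => inner ℂ f (mulOp (a R) ⟨C, ha R⟩ g)) atTop
      (nhds (inner ℂ f (mulOp b hb g))) := by
  simp only [lp.inner_eq_tsum]
  refine tendsto_tsum_of_dominated_convergence
    (bound := fun n => C * (‖f n‖ ^ 2 + ‖g n‖ ^ 2)) ?_ ?_ ?_
  · exact (f.summable_norm_sq.add g.summable_norm_sq).mul_left C
  · intro n
    simp only [mulOp_apply, RCLike.inner_apply]
    exact (((Complex.continuous_ofReal.tendsto _).comp (hab n)).mul_const _).mul_const _
  · refine Eventually.of_forall fun R n => ?_
    have h0 : 0 ≤ C := (abs_nonneg _).trans (ha R n)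
    simp only [mulOp_apply, RCLike.inner_apply, norm_mul, Complex.norm_real, Real.norm_eq_abs,
      RCLike.norm_conj]
    have h1 : |a R n| * (‖g n‖ * ‖f n‖) ≤ C * (‖g n‖ * ‖f n‖) := by
      gcongr
      exact ha R n
    have h2 : ‖g n‖ * ‖f n‖ ≤ ‖f n‖ ^ 2 + ‖g n‖ ^ 2 := by
      nlinarith [sq_nonneg (‖f n‖ - ‖g n‖), sq_nonneg (‖f n‖), sq_nonneg (‖g n‖)]
    nlinarith [mul_le_mul_of_nonneg_left h2 h0]

/-- Shifts generate a representation of the Laurent polynomial algebra on `ℓ²(ℤ²)`. -/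
def laurentRep : AddMonoidAlgebra ℂ (ℤ × ℤ) →ₐ[ℂ] (H2 →L[ℂ] H2) :=
  AddMonoidAlgebra.lift ℂ (H2 →L[ℂ] H2) (ℤ × ℤ)
    { toFun := fun d => shift d.toAdd
      map_one' := by
        ext f n
        simp
      map_mul' := fun d e => by
        ext f n
        simp [add_assoc] }

theorem laurentRep_single (d : ℤ × ℤ) : laurentRep (AddMonoidAlgebra.single d 1) = shift d := by
  simp [laurentRep]

/-- The origin and its six neighbours in the triangular lattice. -/
def nbr : Finset (ℤ × ℤ) := {(0, 0), (1, 0), (-1, 0), (0, 1), (0, -1), (1, -1), (-1, 1)}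

theorem neg_mem_nbr {d : ℤ × ℤ} : -d ∈ nbr ↔ d ∈ nbr := by
  rcases d with ⟨a, b⟩
  simp only [nbr, Finset.mem_insert, Finset.mem_singleton, Prod.neg_mk, Prod.mk.injEq]
  omega

theorem sum_nbr_neg {M : Type*} [AddCommMonoid M] (F : ℤ × ℤ → M) :
    ∑ d ∈ nbr, F (-d) = ∑ d ∈ nbr, F d :=
  Finset.sum_equiv (Equiv.neg _) (fun _ => neg_mem_nbr.symm) fun _ _ => rfl

theorem abs_le_one_of_mem_nbr {d : ℤ × ℤ} (hd : d ∈ nbr) :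
    |(d.1 : ℝ)| ≤ 1 ∧ |(d.2 : ℝ)| ≤ 1 := by
  simp only [nbr, Finset.mem_insert, Finset.mem_singleton] at hd
  rcases hd with rfl | rfl | rfl | rfl | rfl | rfl | rfl <;> norm_num

/-- The finite range operator `∑ e, w e • S_e`, summed over the neighbours. -/
def hopOp (w : ℤ × ℤ → ℤ) : H2 →L[ℂ] H2 := ∑ e ∈ nbr, (w e : ℂ) • shift e

theorem hopOp_eq_sum (w : ℤ × ℤ → ℤ) (f : H2) :
    hopOp w f = ∑ e ∈ nbr, (w e : ℂ) • shift e f := by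
  simp [hopOp]

theorem inner_hopOp_left {w : ℤ × ℤ → ℤ} (hw : ∀ e, w (-e) = -w e) (f g : H2) :
    inner ℂ (hopOp w f) g = -inner ℂ f (hopOp w g) := by
  simp only [hopOp_eq_sum, sum_inner, inner_sum, inner_smul_left, inner_smul_right,
    inner_shift_left, map_intCast]
  rw [← sum_nbr_neg, ← Finset.sum_neg_distrib]
  refine Finset.sum_congr rfl fun e _ => ?_
  simp [hw]

theorem norm_sq_hopOp {w : ℤ × ℤ → ℤ} (hw : ∀ e, w (-e) = -w e) (f : H2) :
    ((‖hopOp w f‖ ^ 2 : ℝ) : ℂ) =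
      -∑ d ∈ nbr, ∑ e ∈ nbr, ((w d * w e : ℤ) : ℂ) * inner ℂ f (shift (d + e) f) := by
  have h := inner_hopOp_left hw f (hopOp w f)
  rw [inner_self_eq_norm_sq_to_K] at h
  rw [Complex.ofReal_pow]
  refine h.trans ?_
  congr 1
  rw [hopOp_eq_sum w (hopOp w f), hopOp_eq_sum w f, inner_sum]
  refine Finset.sum_congr rfl fun d _ => ?_
  rw [inner_smul_right, map_sum, inner_sum, Finset.mul_sum]
  refine Finset.sum_congr rfl fun e _ => ?_
  rw [map_smul, inner_smul_right, shift_shift]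
  push_cast
  ring

/-- Truncation of `t` to `[-R, R]`. -/
def clip (R : ℕ) (t : ℤ) : ℝ := max (-(R : ℝ)) (min (t : ℝ) R)

theorem abs_clip_le (R : ℕ) (t : ℤ) : |clip R t| ≤ R := by
  have : (0 : ℝ) ≤ R := Nat.cast_nonneg R
  exact abs_le.2 ⟨le_max_left _ _, max_le (by linarith) (min_le_right _ _)⟩

theorem abs_clip_sub_clip_le (R : ℕ) (s t : ℤ) : |clip R s - clip R t| ≤ |(s : ℝ) - t| := by
  unfold clip
  refine (abs_max_sub_max_le_max _ _ _ _).trans (max_le (by simp) ?_)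
  exact (abs_min_sub_min_le_max _ _ _ _).trans (max_le le_rfl (by simp))

theorem clip_eq_self {R : ℕ} {t : ℤ} (h : |(t : ℝ)| ≤ R) : clip R t = t := by
  rw [abs_le] at h
  simp [clip, h.1, h.2]

theorem clip_zero (R : ℕ) : clip R 0 = 0 := by
  simpa using clip_eq_self (R := R) (t := 0) (by simp)

/-- The linear form `n ↦ e · n`. -/
def dot (e n : ℤ × ℤ) : ℝ := e.1 * n.1 + e.2 * n.2

/-- The linear form `n ↦ e · n` with truncated coordinates. -/
def dotClip (R : ℕ) (e n : ℤ × ℤ) : ℝ := e.1 * clip R n.1 + e.2 * clip R n.2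

theorem abs_dotClip_le {R : ℕ} {e n : ℤ × ℤ} (he : e ∈ nbr) : |dotClip R e n| ≤ |dot e n| := by
  have h1 := abs_clip_sub_clip_le R n.1 0
  have h2 := abs_clip_sub_clip_le R n.2 0
  have h3 := abs_clip_sub_clip_le R n.1 n.2
  have h4 := abs_clip_sub_clip_le R n.2 n.1
  simp only [clip_zero, Int.cast_zero, sub_zero] at h1 h2
  simp only [nbr, Finset.mem_insert, Finset.mem_singleton] at he
  rcases he with rfl | rfl | rfl | rfl | rfl | rfl | rfl <;>
    simp [dotClip, dot, ← sub_eq_add_neg, neg_add_eq_sub] <;> assumption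

theorem abs_dotClip_le_nat {R : ℕ} {e n : ℤ × ℤ} (he : e ∈ nbr) : |dotClip R e n| ≤ 2 * R := by
  obtain ⟨h1, h2⟩ := abs_le_one_of_mem_nbr he
  refine (abs_add_le _ _).trans ?_
  rw [abs_mul, abs_mul]
  have := mul_le_mul h1 (abs_clip_le R n.1) (abs_nonneg _) zero_le_one
  have := mul_le_mul h2 (abs_clip_le R n.2) (abs_nonneg _) zero_le_one
  linarith

theorem abs_dotClip_add_sub_le {R : ℕ} {d e n : ℤ × ℤ} (hd : d ∈ nbr) (he : e ∈ nbr) :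
    |dotClip R e (n + d) - dotClip R e n| ≤ 2 := by
  obtain ⟨h1, h2⟩ := abs_le_one_of_mem_nbr he
  obtain ⟨h3, h4⟩ := abs_le_one_of_mem_nbr hd
  have h5 := abs_clip_sub_clip_le R (n + d).1 n.1
  have h6 := abs_clip_sub_clip_le R (n + d).2 n.2
  simp only [Prod.fst_add, Prod.snd_add, Int.cast_add, add_sub_cancel_left] at h5 h6
  have h : dotClip R e (n + d) - dotClip R e n =
      e.1 * (clip R (n + d).1 - clip R n.1) + e.2 * (clip R (n + d).2 - clip R n.2) := by
    simp only [dotClip]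
    ring
  rw [h]
  refine (abs_add_le _ _).trans ?_
  rw [abs_mul, abs_mul]
  have := mul_le_mul h1 (h5.trans h3) (abs_nonneg _) zero_le_one
  have := mul_le_mul h2 (h6.trans h4) (abs_nonneg _) zero_le_one
  simp only [Prod.fst_add, Prod.snd_add] at *
  linarith

theorem tendsto_clip (t : ℤ) : Tendsto (fun R => clip R t) atTop (nhds t) := by
  obtain ⟨N, hN⟩ := exists_nat_ge |(t : ℝ)|
  refine tendsto_const_nhds.congr' ?_
  filter_upwards [eventually_ge_atTop N] with R hR
  exact (clip_eq_self (hN.trans (by exact_mod_cast hR))).symm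

theorem tendsto_dotClip (e n : ℤ × ℤ) :
    Tendsto (fun R => dotClip R e n) atTop (nhds (dot e n)) :=
  ((tendsto_clip n.1).const_mul _).add ((tendsto_clip n.2).const_mul _)

/-- The commutator of `∑ d, h d • S_d` with the truncated conjugate operator `∑ e, (e · n) S_e`
has matrix elements `g d * (e · d)` up to terms dominated by `W`. For an eigenvector the
expectation of the commutator vanishes, which bounds the expectation of its main part. -/
theorem norm_virial_le {h : ℤ × ℤ → ℤ × ℤ → ℝ} {g : ℤ × ℤ → ℝ} {T : H2 →L[ℂ] H2}
    (hT : ∀ f n, T f n = ∑ d ∈ nbr, (h d n : ℂ) * f (n + d))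
    (hsymm : ∀ f g : H2, inner ℂ (T f) g = inner ℂ f (T g))
    {W : ℤ × ℤ → ℝ} (hW : ∃ C, ∀ n, |W n| ≤ C)
    (hhW : ∀ d ∈ nbr, ∀ e ∈ nbr, ∀ n,
      2 * |h d n - g d| + |dot e n * (h d n - h d (n + e))| ≤ W n)
    {f : H2} {lam : ℝ} (hf : T f = (lam : ℂ) • f) :
    ‖∑ d ∈ nbr, ∑ e ∈ nbr, ((g d * dot e d : ℝ) : ℂ) * inner ℂ f (shift (d + e) f)‖ ≤
      49 * (‖mulOp W hW f‖ * ‖f‖) := by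
  have hδ : ∀ d e : nbr, ∀ R n, |g d * (dotClip R e (n + d) - dotClip R e n)| ≤ |g d| * 2 := by
    intro d e R n
    rw [abs_mul]
    gcongr
    exact abs_dotClip_add_sub_le d.2 e.2
  have hcW : ∀ d e : nbr, ∀ R n, |(h d n - g d) * (dotClip R e (n + d) - dotClip R e n) +
      dotClip R e n * (h d n - h d (n + e))| ≤ W n := by
    intro d e R n
    refine le_trans ?_ (hhW d d.2 e e.2 n)
    refine (abs_add_le _ _).trans ?_
    rw [abs_mul, abs_mul, abs_mul, mul_comm]
    exact add_le_add
      (mul_le_mul_of_nonneg_right (abs_dotClip_add_sub_le d.2 e.2) (abs_nonneg _))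
      (mul_le_mul_of_nonneg_right (abs_dotClip_le e.2) (abs_nonneg _))
  have hc : ∀ d e : nbr, ∀ R, ∃ C, ∀ n, |(h d n - g d) * (dotClip R e (n + d) - dotClip R e n) +
      dotClip R e n * (h d n - h d (n + e))| ≤ C := fun d e R =>
    hW.imp fun C hC n => (hcW d e R n).trans ((le_abs_self _).trans (hC n))
  have hcomm : ∀ R : ℕ, ∑ d : nbr, ∑ e : nbr, (inner ℂ f (mulOp _ ⟨_, hδ d e R⟩ (shift (d + e) f)) +
      inner ℂ f (mulOp _ (hc d e R) (shift (d + e) f))) = 0 := by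
    intro R
    let B : H2 →L[ℂ] H2 := ∑ e : nbr, mulOp (dotClip R e) ⟨_, fun _ => abs_dotClip_le_nat e.2⟩ ∘L
      shift e
    have hB : ∀ u n, B u n = ∑ e ∈ nbr, (dotClip R e n : ℂ) * u (n + e) := by
      intro u n
      rw [← Finset.sum_coe_sort]
      simp only [B, _root_.sum_apply, ContinuousLinearMap.comp_apply, lp.coeFn_sum,
        Finset.sum_apply, mulOp_apply, shift_apply]
    have h0 : inner ℂ f (T (B f) - B (T f)) = 0 := by
      rw [inner_sub_right, ← hsymm, hf, map_smul, inner_smul_left, inner_smul_right]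
      simp
    rw [← h0]
    simp only [← inner_add_right, ← inner_sum]
    congr 1
    ext n
    rw [lp.coeFn_sub, Pi.sub_apply, hT, hB]
    simp only [hT, hB, lp.coeFn_sum, Finset.sum_apply, lp.coeFn_add, Pi.add_apply, mulOp_apply,
      shift_apply, Finset.mul_sum]
    rw [Finset.sum_comm (s := nbr) (t := nbr) (f := fun e d => (dotClip R e n : ℂ) *
      ((h d (n + e) : ℂ) * f (n + e + d))), ← Finset.sum_sub_distrib, ← Finset.sum_coe_sort nbr]
    refine Finset.sum_congr rfl fun d _ => ?_
    rw [← Finset.sum_sub_distrib, ← Finset.sum_coe_sort nbr]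
    refine Finset.sum_congr rfl fun e _ => ?_
    rw [add_assoc n, add_assoc n, add_comm (e : ℤ × ℤ) d]
    push_cast
    ring
  have hbound : ∀ R : ℕ, ‖∑ d : nbr, ∑ e : nbr,
      inner ℂ f (mulOp _ ⟨_, hδ d e R⟩ (shift (d + e) f))‖ ≤ 49 * (‖mulOp W hW f‖ * ‖f‖) := by
    intro R
    have h1 := hcomm R
    simp only [Finset.sum_add_distrib] at h1
    rw [eq_neg_of_add_eq_zero_left h1, norm_neg]
    have hcard : Fintype.card nbr = 7 := by decide
    refine (norm_sum_le_of_le _ fun d _ => norm_sum_le_of_le _ fun e _ =>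
      norm_inner_mulOp_le (hc d e R) hW (hcW d e R) f (shift (d + e) f)).trans ?_
    simp only [norm_shift, Finset.sum_const, Finset.card_univ, hcard, nsmul_eq_mul]
    push_cast
    linarith
  have hlim : ∀ d e : nbr, Tendsto (fun R => inner ℂ f (mulOp _ ⟨_, hδ d e R⟩ (shift (d + e) f)))
      atTop (nhds (((g d * dot e d : ℝ) : ℂ) * inner ℂ f (shift (d + e) f))) := by
    intro d e
    have h1 := tendsto_inner_mulOp (hδ d e) (b := fun _ => g d * dot e d) ⟨_, fun _ => le_rfl⟩
      (fun n => by
        have h2 := (((tendsto_dotClip e (n + d)).sub (tendsto_dotClip e n)).const_mul (g d))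
        convert h2 using 3
        simp only [dot, Prod.fst_add, Prod.snd_add]
        push_cast
        ring) f (shift (d + e) f)
    convert h1 using 2
    rw [← inner_smul_right]
    rfl
  have hlim' := tendsto_finsetSum Finset.univ fun (d : nbr) _ =>
    tendsto_finsetSum Finset.univ fun (e : nbr) _ => hlim d e
  have := le_of_tendsto hlim'.norm (Eventually.of_forall hbound)
  simp only [← Finset.sum_coe_sort nbr]
  exact this

/-- The critical values of `6 F`, where `F = (x + x⁻¹ + y + y⁻¹ + x y⁻¹ + x⁻¹ y) / 6`, are the roots
of `(t - 6) (t + 3) (t + 2)`: this polynomial in `6 F` lies in the gradient ideal of `F`. -/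
theorem gradient_ideal {R : Type*} [CommRing R] {x x' y y' : R}
    (hx : x * x' = 1) (hy : y * y' = 1) :
    ∃ u v : R, (x + x' + y + y' + x * y' + x' * y - 6) *
      (x + x' + y + y' + x * y' + x' * y + 3) * (x + x' + y + y' + x * y' + x' * y + 2) =
        u * (x - x' + x * y' - x' * y) + v * (y - y' - x * y' + x' * y) := by
  refine ⟨-x'^2 - 8 * x'^2 * y + 5 * x'^2 * y^2 + 3 * x' * y' - 13 * x' - 8 * x' * y + 8 * x' * y^2 + 2 * y'^2 + 3 * y'
        - 11 + 3 * y + 3 * y^2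
        + 3 * x * y'^2 + 2 * x * y' + 2 * x + 3 * x * y + x^2 * y'^2 + 2 * x^2 * y' + x^2,
    -6 * x'^2 + 6 * x'^2 * y^2 - 5 * x' * y' - 5 * x' + 5 * x' * y + 5 * x' * y^2 - y'^2 + y^2, ?_⟩
  grind

/-- The weight of the operator `6 Δ` on the neighbours. -/
def lapWeight (e : ℤ × ℤ) : ℤ := if e = 0 then 0 else 1

theorem exists_norm_le_of_avoids_thresholds {K : Set ℝ} (hK : IsCompact K)
    (hthr : K ∩ ({-(1/2), -(1/3), 1} : Set ℝ) = ∅) :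
    ∃ C : ℝ, ∀ lam ∈ K, ∀ f : H2, ‖f‖ ≤ C * (‖hopOp Prod.fst f‖ + ‖hopOp Prod.snd f‖ +
      ‖hopOp lapWeight f - (6 * lam : ℂ) • f‖) := by
  let s : ℤ × ℤ → AddMonoidAlgebra ℂ (ℤ × ℤ) := fun d => AddMonoidAlgebra.single d 1
  have hs : ∀ d e, s d * s e = s (d + e) := fun d e => by
    simp [s, AddMonoidAlgebra.single_mul_single]
  have hrep : ∀ d, laurentRep (s d) = shift d := laurentRep_single
  have hx : s (1, 0) * s (-1, 0) = 1 := hs _ _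
  have hy : s (0, 1) * s (0, -1) = 1 := hs _ _
  obtain ⟨u, v, huv⟩ := gradient_ideal hx hy
  have h1 : laurentRep (s (1, 0) - s (-1, 0) + s (1, 0) * s (0, -1) - s (-1, 0) * s (0, 1)) =
      hopOp Prod.fst := by
    simp only [hs, map_add, map_sub, hrep]
    simp [hopOp, nbr]
    abel
  have h2 : laurentRep (s (0, 1) - s (0, -1) - s (1, 0) * s (0, -1) + s (-1, 0) * s (0, 1)) =
      hopOp Prod.snd := by
    simp only [hs, map_add, map_sub, hrep]
    simp [hopOp, nbr]
    abel
  have h3 : laurentRep (s (1, 0) + s (-1, 0) + s (0, 1) + s (0, -1) + s (1, 0) * s (0, -1) +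
      s (-1, 0) * s (0, 1)) = hopOp lapWeight := by
    simp only [hs, map_add, hrep]
    simp [hopOp, nbr, lapWeight]
    abel
  generalize s (1, 0) - s (-1, 0) + s (1, 0) * s (0, -1) - s (-1, 0) * s (0, 1) = p₁ at *
  generalize s (0, 1) - s (0, -1) - s (1, 0) * s (0, -1) + s (-1, 0) * s (0, 1) = p₂ at *
  generalize s (1, 0) + s (-1, 0) + s (0, 1) + s (0, -1) + s (1, 0) * s (0, -1) +
      s (-1, 0) * s (0, 1) = q at *
  let L := hopOp lapWeight
  let w : ℝ → H2 →L[ℂ] H2 := fun lam =>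
    L * L + (6 * lam : ℂ) • L + ((6 * lam : ℂ) ^ 2) • 1 - L - (6 * lam : ℂ) • 1 - (24 : ℂ) • 1
  let p : ℝ → ℝ := fun lam => (6 * lam - 6) * (6 * lam + 3) * (6 * lam + 2)
  have hp : ∀ lam ∈ K, p lam ≠ 0 := by
    intro lam hlam h0
    have hnot : lam ∉ ({-(1/2), -(1/3), 1} : Set ℝ) := fun h =>
      (Set.eq_empty_iff_forall_notMem.1 hthr) lam ⟨hlam, h⟩
    simp only [Set.mem_insert_iff, Set.mem_singleton_iff, not_or] at hnot
    rcases mul_eq_zero.1 h0 with h | h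
    · rcases mul_eq_zero.1 h with h | h
      · exact hnot.2.2 (by linarith)
      · exact hnot.1 (by linarith)
    · exact hnot.2.1 (by linarith)
  have hid : ∀ (lam : ℝ) (f : H2), (p lam : ℂ) • f = laurentRep u (hopOp Prod.fst f) +
      laurentRep v (hopOp Prod.snd f) - w lam (L f - (6 * lam : ℂ) • f) := by
    intro lam f
    let t := algebraMap ℂ (AddMonoidAlgebra ℂ (ℤ × ℤ)) (6 * lam)
    have key : (t - 6) * (t + 3) * (t + 2) =
        u * p₁ + v * p₂ - (q * q + t * q + t ^ 2 - q - t - 24) * (q - t) := by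
      linear_combination huv
    have key' := congrArg (fun a => laurentRep a f) key
    have ht : (t - 6) * (t + 3) * (t + 2) =
        algebraMap ℂ (AddMonoidAlgebra ℂ (ℤ × ℤ)) (p lam) := by
      have hcast : (p lam : ℂ) = (6 * lam - 6) * (6 * lam + 3) * (6 * lam + 2) := by simp [p]
      simp only [hcast, t, map_mul, map_sub, map_add, map_ofNat]
    rw [ht] at key'
    have h24 : (24 : AddMonoidAlgebra ℂ (ℤ × ℤ)) = algebraMap ℂ _ 24 := (map_ofNat _ 24).symm
    rw [h24] at key'
    simp only [t, map_sub, map_add, map_mul, map_pow, h1, h2, h3, AlgHom.commutes] at key'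
    simp only [← map_mul, ← map_pow] at key'
    simp only [Algebra.algebraMap_eq_smul_one, smul_mul_assoc, one_mul] at key'
    exact key'
  have hcont : ContinuousOn
      (fun lam => (‖laurentRep u‖ + ‖laurentRep v‖ + ‖w lam‖) / |p lam|) K := by
    refine ContinuousOn.div ?_ ?_ fun lam hlam => abs_ne_zero.2 (hp lam hlam)
    · fun_prop
    · fun_prop
  obtain ⟨C, hC⟩ := hK.exists_bound_of_continuousOn hcont
  refine ⟨C, fun lam hlam f => ?_⟩
  have hpos : 0 < |p lam| := abs_pos.2 (hp lam hlam)
  have hle : |p lam| * ‖f‖ ≤ (‖laurentRep u‖ + ‖laurentRep v‖ + ‖w lam‖) *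
      (‖hopOp Prod.fst f‖ + ‖hopOp Prod.snd f‖ + ‖L f - (6 * lam : ℂ) • f‖) := by
    have h4 : |p lam| * ‖f‖ = ‖(p lam : ℂ) • f‖ := by
      rw [norm_smul, Complex.norm_real, Real.norm_eq_abs]
    rw [h4, hid]
    refine (norm_sub_le _ _).trans ((add_le_add_left (norm_add_le _ _) _).trans ?_)
    have := (laurentRep u).le_opNorm (hopOp Prod.fst f)
    have := (laurentRep v).le_opNorm (hopOp Prod.snd f)
    have := (w lam).le_opNorm (L f - (6 * lam : ℂ) • f)
    have n1 := norm_nonneg (laurentRep u)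
    have n2 := norm_nonneg (laurentRep v)
    have n3 := norm_nonneg (w lam)
    have n4 := norm_nonneg (hopOp Prod.fst f)
    have n5 := norm_nonneg (hopOp Prod.snd f)
    have n6 := norm_nonneg (L f - (6 * lam : ℂ) • f)
    nlinarith [mul_nonneg n1 n5, mul_nonneg n1 n6, mul_nonneg n2 n4, mul_nonneg n2 n6,
      mul_nonneg n3 n4, mul_nonneg n3 n5]
  have h5 := (le_abs_self _).trans (hC lam hlam)
  rw [div_le_iff₀ hpos] at h5
  refine le_of_mul_le_mul_left (hle.trans ?_) hpos
  rw [← mul_assoc, mul_comm |p lam| C]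
  exact mul_le_mul_of_nonneg_right h5 (by positivity)

/-- `v` converges to `c` at infinity, and its differences along the lattice directions `e` are
`o(1 / (e · n))`. -/
structure SlowlyVarying (v : ℤ × ℤ → ℝ) (c : ℝ) : Prop where
  tendsto : Tendsto v cofinite (nhds c)
  tendsto_dot_mul : ∀ e ∈ nbr, Tendsto (fun n => dot e n * (v n - v (n + e))) cofinite (nhds 0)

theorem tendsto_add_cofinite (d : ℤ × ℤ) : Tendsto (fun n => n + d) cofinite cofinite :=
  (add_left_injective d).tendsto_cofinite

theorem tendsto_dot_mul_neg {v : ℤ × ℤ → ℝ} {c : ℝ} (hv : Tendsto v cofinite (nhds c))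
    {e : ℤ × ℤ} (he : Tendsto (fun n => dot e n * (v n - v (n + e))) cofinite (nhds 0)) :
    Tendsto (fun n => dot (-e) n * (v n - v (n + -e))) cofinite (nhds 0) := by
  have h1 := he.comp (tendsto_add_cofinite (-e))
  have h2 := ((hv.comp (tendsto_add_cofinite (-e))).sub hv).const_mul (dot e e)
  have h3 := h1.add h2
  rw [sub_self, mul_zero, add_zero] at h3
  refine h3.congr fun n => ?_
  simp only [Function.comp_apply, neg_add_cancel_right, dot, Prod.fst_add, Prod.snd_add,
    Prod.fst_neg, Prod.snd_neg]
  push_cast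
  ring

theorem SlowlyVarying.of_pos {v : ℤ × ℤ → ℝ} {c : ℝ} (hv : Tendsto v cofinite (nhds c))
    (h1 : Tendsto (fun n => dot (1, 0) n * (v n - v (n + (1, 0)))) cofinite (nhds 0))
    (h2 : Tendsto (fun n => dot (0, 1) n * (v n - v (n + (0, 1)))) cofinite (nhds 0))
    (h3 : Tendsto (fun n => dot (1, -1) n * (v n - v (n + (1, -1)))) cofinite (nhds 0)) :
    SlowlyVarying v c := by
  refine ⟨hv, fun e he => ?_⟩
  simp only [nbr, Finset.mem_insert, Finset.mem_singleton] at he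
  rcases he with rfl | rfl | rfl | rfl | rfl | rfl | rfl
  · simp [dot]
  · exact h1
  · rw [show ((-1, 0) : ℤ × ℤ) = -(1, 0) by simp]
    exact tendsto_dot_mul_neg hv h1
  · exact h2
  · rw [show ((0, -1) : ℤ × ℤ) = -(0, 1) by simp]
    exact tendsto_dot_mul_neg hv h2
  · exact h3
  · rw [show ((-1, 1) : ℤ × ℤ) = -(1, -1) by simp]
    exact tendsto_dot_mul_neg hv h3

theorem abs_le_jap (t : ℝ) : |t| ≤ jap t := by
  rw [← Real.sqrt_sq_eq_abs]
  exact Real.sqrt_le_sqrt (by linarith)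

theorem tendsto_Lam : Tendsto Lam cofinite atTop := by
  rw [← cocompact_eq_cofinite]
  refine tendsto_atTop_mono (fun n => ?_) (tendsto_norm_cocompact_atTop (E := ℤ × ℤ))
  have h1 := abs_le_jap n.1
  have h2 := abs_le_jap n.2
  have h3 := abs_nonneg (n.1 : ℝ)
  have h4 := abs_nonneg (n.2 : ℝ)
  rw [Prod.norm_def, Int.norm_eq_abs, Int.norm_eq_abs, Lam]
  exact max_le (by linarith) (by linarith)

theorem tendsto_mul_of_Lam_bound {ε : ℝ} (hε : 0 < ε) {t v : ℤ × ℤ → ℝ}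
    (h : ∃ C : ℝ, ∀ n, Lam n ^ ε * jap (t n) * |v n| ≤ C) :
    Tendsto (fun n => t n * v n) cofinite (nhds 0) := by
  obtain ⟨C, hC⟩ := h
  have h1 : Tendsto (fun n => C / Lam n ^ ε) cofinite (nhds 0) :=
    tendsto_const_nhds.div_atTop ((tendsto_rpow_atTop hε).comp tendsto_Lam)
  refine squeeze_zero_norm' ?_ h1
  filter_upwards [tendsto_Lam.eventually_gt_atTop 0] with n hn
  have h2 : 0 < Lam n ^ ε := Real.rpow_pos_of_pos hn ε
  rw [le_div_iff₀ h2, Real.norm_eq_abs, abs_mul]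
  refine le_trans ?_ (hC n)
  have := mul_le_mul_of_nonneg_right (abs_le_jap (t n))
    (mul_nonneg h2.le (abs_nonneg (v n)))
  linarith

theorem SlowlyVarying.of_Lam_bound {ε : ℝ} (hε : 0 < ε) {v : ℤ × ℤ → ℝ} {c : ℝ}
    (hv : Tendsto v cofinite (nhds c))
    (h1 : ∃ C : ℝ, ∀ n : ℤ × ℤ, Lam n ^ ε * jap (n.1 : ℝ) * |v n - v (n.1 + 1, n.2)| ≤ C)
    (h2 : ∃ C : ℝ, ∀ n : ℤ × ℤ, Lam n ^ ε * jap (n.2 : ℝ) * |v n - v (n.1, n.2 + 1)| ≤ C)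
    (h3 : ∃ C : ℝ, ∀ n : ℤ × ℤ,
      Lam n ^ ε * jap ((n.1 : ℝ) - (n.2 : ℝ)) * |v n - v (n.1 + 1, n.2 - 1)| ≤ C) :
    SlowlyVarying v c := by
  refine .of_pos hv ((tendsto_mul_of_Lam_bound hε h1).congr fun n => ?_)
    ((tendsto_mul_of_Lam_bound hε h2).congr fun n => ?_)
    ((tendsto_mul_of_Lam_bound hε h3).congr fun n => ?_) <;>
  simp [dot, Prod.add_def, sub_eq_add_neg]

theorem SlowlyVarying.comp_add {v : ℤ × ℤ → ℝ} {c : ℝ} (hv : SlowlyVarying v c) (d : ℤ × ℤ) :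
    SlowlyVarying (fun n => v (n + d)) c := by
  refine ⟨hv.1.comp (tendsto_add_cofinite d), fun e he => ?_⟩
  have h1 := (hv.2 e he).comp (tendsto_add_cofinite d)
  have h2 := ((hv.1.comp (tendsto_add_cofinite d)).sub
    (hv.1.comp (tendsto_add_cofinite (e + d)))).const_mul (dot e d)
  have h3 := h1.sub h2
  rw [sub_self, mul_zero, sub_zero] at h3
  refine h3.congr fun n => ?_
  simp only [Function.comp_apply, dot, Prod.fst_add, Prod.snd_add, add_right_comm n d e,
    ← add_assoc]
  push_cast
  ring

theorem SlowlyVarying.mul {u v : ℤ × ℤ → ℝ} {a b : ℝ} (hu : SlowlyVarying u a)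
    (hv : SlowlyVarying v b) : SlowlyVarying (fun n => u n * v n) (a * b) := by
  refine ⟨hu.1.mul hv.1, fun e he => ?_⟩
  have h := ((hu.2 e he).mul hv.1).add ((hu.1.comp (tendsto_add_cofinite e)).mul (hv.2 e he))
  rw [zero_mul, mul_zero, add_zero] at h
  refine h.congr fun n => ?_
  simp only [Function.comp_apply]
  ring

theorem SlowlyVarying.const_mul {v : ℤ × ℤ → ℝ} {c : ℝ} (hv : SlowlyVarying v c) (a : ℝ) :
    SlowlyVarying (fun n => a * v n) (a * c) := by
  refine ⟨hv.1.const_mul a, fun e he => ?_⟩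
  have h := (hv.2 e he).const_mul a
  rw [mul_zero] at h
  exact h.congr fun n => by ring

theorem SlowlyVarying.inv_sqrt_one_add {v : ℤ × ℤ → ℝ} (hv : SlowlyVarying v 0)
    (hpos : ∀ n, 0 < 1 + v n) : SlowlyVarying (fun n => (√(1 + v n))⁻¹) 1 := by
  have hs : Tendsto (fun n => √(1 + v n)) cofinite (nhds 1) := by
    simpa using (hv.1.const_add 1).sqrt
  refine ⟨by simpa using hs.inv₀ one_ne_zero, fun e he => ?_⟩
  have hs' := hs.comp (tendsto_add_cofinite e)
  have hden := ((hs.mul hs').mul (hs.add hs')).inv₀ (by norm_num)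
  have h := (hv.2 e he).neg.mul hden
  rw [neg_zero, zero_mul] at h
  refine h.congr fun n => ?_
  have h1 := Real.sqrt_pos.2 (hpos n)
  have h2 := Real.sqrt_pos.2 (hpos (n + e))
  have h3 := Real.sq_sqrt (hpos n).le
  have h4 := Real.sq_sqrt (hpos (n + e)).le
  have h5 : v n - v (n + e) = √(1 + v n) ^ 2 - √(1 + v (n + e)) ^ 2 := by rw [h3, h4]; ring
  simp only [Function.comp_apply]
  rw [h5]
  field_simp
  ring

theorem exists_abs_le_of_tendsto {v : ℤ × ℤ → ℝ} {c : ℝ} (hv : Tendsto v cofinite (nhds c)) :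
    ∃ C, ∀ n, |v n| ≤ C := by
  obtain ⟨C, hC⟩ := hv.abs.bddAbove_range_of_cofinite
  exact ⟨C, fun n => hC ⟨n, rfl⟩⟩

theorem inner_map_eq_of_sum_shift {h : ℤ × ℤ → ℤ × ℤ → ℝ} {T : H2 →L[ℂ] H2}
    (hT : ∀ f n, T f n = ∑ d ∈ nbr, (h d n : ℂ) * f (n + d))
    (hb : ∀ d ∈ nbr, ∃ C, ∀ n, |h d n| ≤ C) (hneg : ∀ d ∈ nbr, ∀ n, h (-d) n = h d (n + -d))
    (f g : H2) : inner ℂ (T f) g = inner ℂ f (T g) := by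
  have h1 : T f = ∑ d : nbr, mulOp (h d) (hb d d.2) (shift d f) := by
    ext n
    rw [hT, lp.coeFn_sum, Finset.sum_apply, ← Finset.sum_coe_sort]
    rfl
  have h2 : T g = ∑ d : nbr, shift (-d) (mulOp (h d) (hb d d.2) g) := by
    ext n
    rw [hT, lp.coeFn_sum, Finset.sum_apply, ← sum_nbr_neg, ← Finset.sum_coe_sort]
    refine Finset.sum_congr rfl fun d _ => ?_
    rw [hneg d d.2, shift_apply, mulOp_apply]
  rw [h1, h2, sum_inner, inner_sum]
  refine Finset.sum_congr rfl fun d _ => ?_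
  rw [inner_mulOp_left, inner_shift_left]

/-- Eigenvectors are almost annihilated by the components of the velocity operator, and are almost
eigenvectors of the unperturbed Laplacian. -/
theorem exists_weight_bound {h : ℤ × ℤ → ℤ × ℤ → ℝ} {T : H2 →L[ℂ] H2}
    (hT : ∀ f n, T f n = ∑ d ∈ nbr, (h d n : ℂ) * f (n + d))
    (hsymm : ∀ f g : H2, inner ℂ (T f) g = inner ℂ f (T g))
    (hh : ∀ d ∈ nbr, SlowlyVarying (h d) (lapWeight d / 6)) :
    ∃ (W : ℤ × ℤ → ℝ) (hW : ∃ C, ∀ n, |W n| ≤ C), Tendsto W cofinite (nhds 0) ∧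
      ∀ (lam : ℝ) (f : H2), T f = (lam : ℂ) • f →
        ‖hopOp Prod.fst f‖ ^ 2 + ‖hopOp Prod.snd f‖ ^ 2 ≤ 294 * (‖mulOp W hW f‖ * ‖f‖) ∧
        ‖hopOp lapWeight f - (6 * lam : ℂ) • f‖ ≤ 42 * ‖mulOp W hW f‖ := by
  let g : ℤ × ℤ → ℝ := fun d => lapWeight d / 6
  let W₁ : ℤ × ℤ → ℤ × ℤ → ℤ × ℤ → ℝ := fun d e n =>
    2 * |h d n - g d| + |dot e n * (h d n - h d (n + e))|
  let W₂ : ℤ × ℤ → ℤ × ℤ → ℝ := fun d n => |h d (n + -d) - g d|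
  let W : ℤ × ℤ → ℝ := fun n => (∑ d ∈ nbr, ∑ e ∈ nbr, W₁ d e n) + ∑ d ∈ nbr, W₂ d n
  have hsub : ∀ d ∈ nbr, Tendsto (fun n => h d n - g d) cofinite (nhds 0) := fun d hd => by
    simpa [g] using (hh d hd).1.sub_const (g d)
  have hW₂ : ∀ d ∈ nbr, Tendsto (W₂ d) cofinite (nhds 0) := fun d hd => by
    simpa using ((hsub d hd).comp (tendsto_add_cofinite (-d))).abs
  have hW₁ : ∀ d ∈ nbr, ∀ e ∈ nbr, Tendsto (W₁ d e) cofinite (nhds 0) := fun d hd e he => by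
    simpa [W₁, abs_mul] using ((hsub d hd).abs.const_mul 2).add ((hh d hd).2 e he).abs
  have hW0 : Tendsto W cofinite (nhds 0) := by
    simpa using (tendsto_finsetSum nbr fun d hd =>
      tendsto_finsetSum nbr fun e he => hW₁ d hd e he).add (tendsto_finsetSum nbr hW₂)
  have hW₁nn : ∀ d e n, 0 ≤ W₁ d e n := fun d e n => by positivity
  have hW₂nn : ∀ d n, 0 ≤ W₂ d n := fun d n => abs_nonneg _
  have hle₁ : ∀ d ∈ nbr, ∀ e ∈ nbr, ∀ n, W₁ d e n ≤ W n := fun d hd e he n =>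
    ((Finset.single_le_sum (fun e _ => hW₁nn d e n) he).trans
      (Finset.single_le_sum (f := fun d => ∑ e ∈ nbr, W₁ d e n)
        (fun d _ => Finset.sum_nonneg fun e _ => hW₁nn d e n) hd)).trans
      (le_add_of_nonneg_right (Finset.sum_nonneg fun d _ => hW₂nn d n))
  have hle₂ : ∀ d ∈ nbr, ∀ n, W₂ d n ≤ W n := fun d hd n =>
    (Finset.single_le_sum (f := fun d => W₂ d n) (fun d _ => hW₂nn d n) hd).trans
      (le_add_of_nonneg_left (Finset.sum_nonneg fun d _ =>
        Finset.sum_nonneg fun e _ => hW₁nn d e n))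
  have hW := exists_abs_le_of_tendsto hW0
  refine ⟨W, hW, hW0, fun lam f hf => ⟨?_, ?_⟩⟩
  · have hvir := norm_virial_le (g := g) hT hsymm hW hle₁ hf
    have hsum : ∑ d ∈ nbr, ∑ e ∈ nbr, ((g d * dot e d : ℝ) : ℂ) * inner ℂ f (shift (d + e) f) =
        (((-1 / 6) * (‖hopOp Prod.fst f‖ ^ 2 + ‖hopOp Prod.snd f‖ ^ 2) : ℝ) : ℂ) := by
      rw [Complex.ofReal_mul, Complex.ofReal_add, norm_sq_hopOp (fun _ => rfl),
        norm_sq_hopOp (fun _ => rfl), ← neg_add, ← Finset.sum_add_distrib, mul_neg, ← neg_mul,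
        Finset.mul_sum]
      refine Finset.sum_congr rfl fun d hd => ?_
      rw [← Finset.sum_add_distrib, Finset.mul_sum]
      refine Finset.sum_congr rfl fun e _ => ?_
      by_cases h0 : d = 0
      · simp [g, h0, lapWeight]
      · simp only [g, lapWeight, h0, if_false, dot]
        push_cast
        ring
    rw [hsum, Complex.norm_real, Real.norm_eq_abs, abs_mul,
      abs_of_nonneg (a := ‖hopOp Prod.fst f‖ ^ 2 + _) (add_nonneg (sq_nonneg _) (sq_nonneg _))]
      at hvir
    norm_num [abs_of_pos] at hvir
    linarith
  · have hb : ∀ d : nbr, ∃ C, ∀ n, |h d (n + -(d : ℤ × ℤ)) - g d| ≤ C := fun d =>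
      hW.imp fun C hC n => (hle₂ d d.2 n).trans ((le_abs_self _).trans (hC n))
    have heq : hopOp lapWeight f - (6 * lam : ℂ) • f =
        -((6 : ℂ) • ∑ d : nbr, shift d (mulOp _ (hb d) f)) := by
      rw [mul_smul, ← hf]
      ext n
      rw [lp.coeFn_sub, Pi.sub_apply, lp.coeFn_neg, Pi.neg_apply, lp.coeFn_smul, Pi.smul_apply,
        lp.coeFn_smul, Pi.smul_apply, hT, hopOp_eq_sum, lp.coeFn_sum, lp.coeFn_sum,
        Finset.sum_apply, Finset.sum_apply, smul_eq_mul, smul_eq_mul, Finset.mul_sum,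
        Finset.mul_sum, ← Finset.sum_sub_distrib, ← Finset.sum_neg_distrib,
        ← Finset.sum_coe_sort nbr]
      refine Finset.sum_congr rfl fun d _ => ?_
      simp only [lp.coeFn_smul, Pi.smul_apply, shift_apply, mulOp_apply, smul_eq_mul, g,
        add_neg_cancel_right]
      push_cast
      ring
    have hcard : Fintype.card nbr = 7 := by decide
    rw [heq, norm_neg, norm_smul]
    have hle : ‖∑ d : nbr, shift d (mulOp _ (hb d) f)‖ ≤ ∑ _d : nbr, ‖mulOp W hW f‖ := by
      refine norm_sum_le_of_le _ fun d _ => ?_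
      rw [norm_shift]
      exact norm_mulOp_le_norm_mulOp _ hW (hle₂ d d.2) f
    rw [Finset.sum_const, Finset.card_univ, hcard, nsmul_eq_mul] at hle
    norm_num at hle ⊢
    linarith

theorem exists_finite_sum_bound {W : ℤ × ℤ → ℝ} (hW : ∃ C, ∀ n, |W n| ≤ C)
    (hW0 : Tendsto W cofinite (nhds 0)) (C : ℝ) :
    ∃ (F : Finset (ℤ × ℤ)) (D : ℝ), 0 ≤ D ∧
      ∀ f : H2, ‖f‖ ≤ C * ‖mulOp W hW f‖ → ‖f‖ ^ 2 ≤ D * ∑ n ∈ F, ‖f n‖ ^ 2 := by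
  obtain ⟨B, hB⟩ := hW
  have hsmall : ∀ᶠ n in cofinite, C ^ 2 * W n ^ 2 < 1 / 2 := by
    have h := (hW0.pow 2).const_mul (C ^ 2)
    rw [zero_pow two_ne_zero, mul_zero] at h
    exact h.eventually_lt_const (by norm_num)
  have hfin : {n | ¬C ^ 2 * W n ^ 2 < 1 / 2}.Finite := hsmall
  refine ⟨hfin.toFinset, 2 * (C ^ 2 * B ^ 2), by positivity, fun f hf => ?_⟩
  have hle : ∀ n, C ^ 2 * ‖mulOp W ⟨B, hB⟩ f n‖ ^ 2 ≤ 1 / 2 * ‖f n‖ ^ 2 +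
      C ^ 2 * B ^ 2 * (if n ∈ hfin.toFinset then ‖f n‖ ^ 2 else 0) := by
    intro n
    rw [mulOp_apply, norm_mul, Complex.norm_real, Real.norm_eq_abs, mul_pow, sq_abs, ← mul_assoc]
    by_cases hn : C ^ 2 * W n ^ 2 < 1 / 2
    · rw [if_neg (by simpa using hn), mul_zero, add_zero]
      gcongr
    · rw [if_pos (by simpa using hn)]
      have h1 : W n ^ 2 ≤ B ^ 2 := sq_le_sq' (abs_le.1 (hB n)).1 (abs_le.1 (hB n)).2
      have h2 : C ^ 2 * W n ^ 2 * ‖f n‖ ^ 2 ≤ C ^ 2 * B ^ 2 * ‖f n‖ ^ 2 := by gcongr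
      have h3 := sq_nonneg ‖f n‖
      linarith
  have hsumF : HasSum (fun n => if n ∈ hfin.toFinset then ‖f n‖ ^ 2 else 0)
      (∑ n ∈ hfin.toFinset, ‖f n‖ ^ 2) := by
    rw [← Finset.sum_congr rfl fun n hn => if_pos hn]
    exact hasSum_sum_of_ne_finset_zero fun n hn => if_neg hn
  have htsum : C ^ 2 * ‖mulOp W ⟨B, hB⟩ f‖ ^ 2 ≤ 1 / 2 * ‖f‖ ^ 2 +
      C ^ 2 * B ^ 2 * ∑ n ∈ hfin.toFinset, ‖f n‖ ^ 2 := by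
    rw [H2.norm_sq_eq_tsum, H2.norm_sq_eq_tsum, ← tsum_mul_left]
    exact hasSum_le hle ((mulOp W ⟨B, hB⟩ f).summable_norm_sq.mul_left _).hasSum
      ((f.summable_norm_sq.hasSum.mul_left _).add (hsumF.mul_left _))
  have hsq := pow_le_pow_left₀ (norm_nonneg f) hf 2
  rw [mul_pow] at hsq
  linarith

theorem exists_finite_sum_bound_of_eigenvector {h : ℤ × ℤ → ℤ × ℤ → ℝ} {T : H2 →L[ℂ] H2}
    (hT : ∀ f n, T f n = ∑ d ∈ nbr, (h d n : ℂ) * f (n + d))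
    (hsymm : ∀ f g : H2, inner ℂ (T f) g = inner ℂ f (T g))
    (hh : ∀ d ∈ nbr, SlowlyVarying (h d) (lapWeight d / 6))
    {K : Set ℝ} (hK : IsCompact K) (hthr : K ∩ ({-(1/2), -(1/3), 1} : Set ℝ) = ∅) :
    ∃ (F : Finset (ℤ × ℤ)) (D : ℝ), 0 ≤ D ∧ ∀ lam ∈ K, ∀ f : H2, T f = (lam : ℂ) • f →
      ‖f‖ ^ 2 ≤ D * ∑ n ∈ F, ‖f n‖ ^ 2 := by
  obtain ⟨W, hW, hW0, hbound⟩ := exists_weight_bound hT hsymm hh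
  obtain ⟨C, hC⟩ := exists_norm_le_of_avoids_thresholds hK hthr
  obtain ⟨F, D, hD, hFD⟩ := exists_finite_sum_bound hW hW0 (2 * (588 * C ^ 2 + 42 * |C|))
  refine ⟨F, D, hD, fun lam hlam f hf => hFD f ?_⟩
  obtain ⟨h1, h2⟩ := hbound lam f hf
  have h3 := hC lam hlam f
  set a := ‖hopOp Prod.fst f‖
  set b := ‖hopOp Prod.snd f‖
  set t := ‖mulOp W hW f‖
  have ha : 0 ≤ a := norm_nonneg _
  have hb : 0 ≤ b := norm_nonneg _
  have ht : 0 ≤ t := norm_nonneg _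
  have hf0 : 0 ≤ ‖f‖ := norm_nonneg _
  have key : ∀ c : ℝ, c ^ 2 ≤ 294 * (t * ‖f‖) → C * c ≤ ‖f‖ / 4 + 294 * C ^ 2 * t := by
    intro c hc
    refine abs_le_of_sq_le_sq' ?_ (by positivity) |>.2
    nlinarith [mul_le_mul_of_nonneg_left hc (sq_nonneg C),
      sq_nonneg (‖f‖ / 4 - 294 * C ^ 2 * t)]
  have hka := key a (by nlinarith)
  have hkb := key b (by nlinarith)
  have hkc : C * ‖hopOp lapWeight f - (6 * lam : ℂ) • f‖ ≤ |C| * (42 * t) :=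
    mul_le_mul (le_abs_self C) h2 (norm_nonneg _) (abs_nonneg C)
  linarith

theorem card_le_of_orthonormal {ι : Type*} [Fintype ι] {v : ι → H2} (hv : Orthonormal ℂ v)
    {F : Finset (ℤ × ℤ)} {D : ℝ} (hD : 0 ≤ D)
    (hFD : ∀ i, ‖v i‖ ^ 2 ≤ D * ∑ n ∈ F, ‖v i n‖ ^ 2) : (Fintype.card ι : ℝ) ≤ D * F.card := by
  have hbessel : ∀ n, ∑ i, ‖v i n‖ ^ 2 ≤ 1 := by
    intro n
    have h := hv.sum_inner_products_le (s := Finset.univ) (lp.single 2 n (1 : ℂ) : H2)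
    simpa [lp.inner_single_right] using h
  calc (Fintype.card ι : ℝ) = ∑ i, ‖v i‖ ^ 2 := by simp [hv.norm_eq_one]
    _ ≤ ∑ i, D * ∑ n ∈ F, ‖v i n‖ ^ 2 := Finset.sum_le_sum fun i _ => hFD i
    _ = D * ∑ n ∈ F, ∑ i, ‖v i n‖ ^ 2 := by rw [← Finset.mul_sum, Finset.sum_comm]
    _ ≤ D * ∑ _n ∈ F, 1 := by gcongr with n; exact hbessel n
    _ = D * F.card := by simp

theorem inner_eq_zero_of_eigenvectors {T : H2 →L[ℂ] H2}
    (hsymm : ∀ f g : H2, inner ℂ (T f) g = inner ℂ f (T g)) {a b : ℝ} (hab : a ≠ b) {f g : H2}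
    (hf : T f = (a : ℂ) • f) (hg : T g = (b : ℂ) • g) : inner ℂ f g = 0 := by
  have h := hsymm f g
  rw [hf, hg, inner_smul_left, inner_smul_right, Complex.conj_ofReal] at h
  have h' : ((a : ℂ) - b) * inner ℂ f g = 0 := by linear_combination h
  exact (mul_eq_zero.1 h').resolve_left (sub_ne_zero.2 (by exact_mod_cast hab))

theorem finite_eigenvalues_of_finite_sum_bound {T : H2 →L[ℂ] H2}
    (hsymm : ∀ f g : H2, inner ℂ (T f) g = inner ℂ f (T g)) {K : Set ℝ}
    {F : Finset (ℤ × ℤ)} {D : ℝ} (hD : 0 ≤ D)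
    (hFD : ∀ lam ∈ K, ∀ f : H2, T f = (lam : ℂ) • f → ‖f‖ ^ 2 ≤ D * ∑ n ∈ F, ‖f n‖ ^ 2) :
    {lam : ℝ | lam ∈ K ∧ ∃ f : H2, f ≠ 0 ∧ T f = (lam : ℂ) • f}.Finite := by
  by_contra hinf
  obtain ⟨N, hN⟩ := exists_nat_gt (D * F.card)
  obtain ⟨s, hs, hcard⟩ := Set.Infinite.exists_subset_card_eq hinf N
  choose f hf0 hf using fun i : s => (hs i.2).2
  let v : s → H2 := fun i => ((‖f i‖ : ℂ)⁻¹) • f i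
  have hv : ∀ i, T (v i) = ((i : ℝ) : ℂ) • v i := fun i => by
    simp only [v, map_smul, hf]
    exact smul_comm _ _ _
  have hortho : Orthonormal ℂ v :=
    ⟨fun i => norm_smul_inv_norm (hf0 i), fun i j hij =>
      inner_eq_zero_of_eigenvectors hsymm (fun h => hij (Subtype.ext h)) (hv i) (hv j)⟩
  have h := card_le_of_orthonormal hortho hD fun i => hFD i (hs i.2).1 (v i) (hv i)
  rw [Fintype.card_coe, hcard] at h
  exact absurd h (not_le.2 hN)

theorem finiteDimensional_ker_of_finite_sum_bound {T : H2 →L[ℂ] H2} {lam : ℝ}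
    {F : Finset (ℤ × ℤ)} {D : ℝ}
    (hFD : ∀ f : H2, T f = (lam : ℂ) • f → ‖f‖ ^ 2 ≤ D * ∑ n ∈ F, ‖f n‖ ^ 2) :
    FiniteDimensional ℂ
      (LinearMap.ker ((T : H2 →ₗ[ℂ] H2) - (lam : ℂ) • (LinearMap.id : H2 →ₗ[ℂ] H2))) := by
  let E := LinearMap.ker ((T : H2 →ₗ[ℂ] H2) - (lam : ℂ) • (LinearMap.id : H2 →ₗ[ℂ] H2))
  let r : E →ₗ[ℂ] (F → ℂ) :=
    { toFun := fun f n => (f : H2) n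
      map_add' := fun _ _ => rfl
      map_smul' := fun _ _ => rfl }
  refine Module.Finite.of_injective r ((injective_iff_map_eq_zero r).2 fun f hf => ?_)
  have hTf : T f = (lam : ℂ) • (f : H2) := sub_eq_zero.1 f.2
  have h := hFD f hTf
  rw [Finset.sum_eq_zero fun n hn => by
    rw [show (f : H2) n = 0 from congrFun hf ⟨n, hn⟩]; simp, mul_zero] at h
  have h0 : ‖(f : H2)‖ = 0 := pow_eq_zero_iff two_ne_zero |>.1 (le_antisymm h (sq_nonneg _))
  exact Subtype.ext (norm_eq_zero.1 h0)

/-- The matrix elements of the perturbed Hamiltonian. -/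
def hamCoeff (η V : ℤ × ℤ → ℝ) (d n : ℤ × ℤ) : ℝ :=
  if d = 0 then V n else 1 / 6 * ((√(1 + η n))⁻¹ * (√(1 + η (n + d)))⁻¹)

theorem hamCoeff_neg (η V : ℤ × ℤ → ℝ) (d n : ℤ × ℤ) :
    hamCoeff η V (-d) n = hamCoeff η V d (n + -d) := by
  unfold hamCoeff
  by_cases hd : d = 0
  · simp [hd]
  · simp only [neg_eq_zero, hd, if_false, neg_add_cancel_right]
    ring

theorem slowlyVarying_hamCoeff {η V : ℤ × ℤ → ℝ} (hη : SlowlyVarying η 0)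
    (hpos : ∀ n, 0 < 1 + η n) (hV : SlowlyVarying V 0) (d : ℤ × ℤ) :
    SlowlyVarying (hamCoeff η V d) (lapWeight d / 6) := by
  by_cases hd : d = 0
  · have h : hamCoeff η V d = V := funext fun n => if_pos hd
    rw [h]
    simpa [lapWeight, hd] using hV
  · have h : hamCoeff η V d = fun n => 1 / 6 * ((√(1 + η n))⁻¹ * (√(1 + η (n + d)))⁻¹) :=
      funext fun n => if_neg hd
    have hμ := hη.inv_sqrt_one_add hpos
    simpa [h, lapWeight, hd] using (hμ.mul (hμ.comp_add d)).const_mul (1 / 6)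

theorem lapPert_add_eq_sum (η V : ℤ × ℤ → ℝ) (f : ℤ × ℤ → ℂ) (n : ℤ × ℤ) :
    lapPert (fun k => 1 + η k) f n + (V n : ℂ) * f n =
      ∑ d ∈ nbr, (hamCoeff η V d n : ℂ) * f (n + d) := by
  simp [nbr, hamCoeff, lapPert, Prod.add_def, sub_eq_add_neg]
  ring

/-- eigenvalues of `H̃` away from the thresholds `{-1/2, -1/3, 1}` are finitely
many in any compact set avoiding the thresholds, and have finite multiplicity. -/
theorem eigenvalues_finite_away_from_thresholds
    (ε : ℝ) (hε : 1/2 < ε) (η : ℤ × ℤ → ℝ)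
    (h0inf : ∃ c : ℝ, -1 < c ∧ ∀ n : ℤ × ℤ, c ≤ η n)
    (h0lim : Filter.Tendsto η Filter.cofinite (nhds 0))
    (h1 : ∃ C : ℝ, ∀ n : ℤ × ℤ,
      Lam n ^ ε * jap (n.1 : ℝ) * |η n - η (n.1 + 1, n.2)| ≤ C)
    (h2 : ∃ C : ℝ, ∀ n : ℤ × ℤ,
      Lam n ^ ε * jap (n.2 : ℝ) * |η n - η (n.1, n.2 + 1)| ≤ C)
    (h3 : ∃ C : ℝ, ∀ n : ℤ × ℤ,
      Lam n ^ ε * jap ((n.1 : ℝ) - (n.2 : ℝ)) * |η n - η (n.1 + 1, n.2 - 1)| ≤ C)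
    (h4 : ∃ C : ℝ, ∀ n : ℤ × ℤ, Lam n ^ ε * |η n| ≤ C)
    (V : ℤ × ℤ → ℝ)
    (hV0 : Filter.Tendsto V Filter.cofinite (nhds 0))
    (hV1 : ∃ C : ℝ, ∀ n : ℤ × ℤ,
      Lam n ^ ε * jap (n.1 : ℝ) * |V n - V (n.1 + 1, n.2)| ≤ C)
    (hV2 : ∃ C : ℝ, ∀ n : ℤ × ℤ,
      Lam n ^ ε * jap (n.2 : ℝ) * |V n - V (n.1, n.2 + 1)| ≤ C)
    (hV3 : ∃ C : ℝ, ∀ n : ℤ × ℤ,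
      Lam n ^ ε * jap ((n.1 : ℝ) - (n.2 : ℝ)) * |V n - V (n.1 + 1, n.2 - 1)| ≤ C)
    (Ht : H2 →L[ℂ] H2)
    (hHt : ∀ (f : H2) (n : ℤ × ℤ),
      Ht f n = lapPert (fun k => 1 + η k) (⇑f) n + (V n : ℂ) * f n)
    (K : Set ℝ) (hK : IsCompact K)
    (hthr : K ∩ ({-(1/2), -(1/3), 1} : Set ℝ) = ∅) :
    {lam : ℝ | lam ∈ K ∧ ∃ f : H2, f ≠ 0 ∧ Ht f = (lam : ℂ) • f}.Finite ∧
    ∀ lam ∈ K, FiniteDimensional ℂ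
      (LinearMap.ker ((Ht : H2 →ₗ[ℂ] H2) - (lam : ℂ) • (LinearMap.id : H2 →ₗ[ℂ] H2))) := by
  obtain ⟨c, hc, hηc⟩ := h0inf
  have hε0 : 0 < ε := by linarith
  have hpos : ∀ n, 0 < 1 + η n := fun n => by linarith [hηc n]
  have hη : SlowlyVarying η 0 := .of_Lam_bound hε0 h0lim h1 h2 h3
  have hV : SlowlyVarying V 0 := .of_Lam_bound hε0 hV0 hV1 hV2 hV3
  have hcoeff := slowlyVarying_hamCoeff hη hpos hV
  have hT : ∀ (f : H2) n, Ht f n = ∑ d ∈ nbr, (hamCoeff η V d n : ℂ) * f (n + d) :=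
    fun f n => (hHt f n).trans (lapPert_add_eq_sum η V f n)
  have hsymm := inner_map_eq_of_sum_shift hT (fun d _ => exists_abs_le_of_tendsto (hcoeff d).1)
    fun d _ n => hamCoeff_neg η V d n
  obtain ⟨F, D, hD, hFD⟩ := exists_finite_sum_bound_of_eigenvector hT hsymm
    (fun d _ => hcoeff d) hK hthr
  exact ⟨finite_eigenvalues_of_finite_sum_bound hsymm hD hFD, fun lam hlam =>
    finiteDimensional_ker_of_finite_sum_bound (hFD lam hlam)⟩
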